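/- arXiv:1012.3973 — 8 statements merged into one kernel-verified Lean document; each statement's English description precedes it below -/
import Mathlib

section
/- Let X be a locally compact Hausdorff space countable at infinity and let S ⊆ C(X) be a convex cone containing the constant functions. If the multifunction J^S = {(x,μ) : x ∈ X, μ ∈ J^S_x} is lower semicontinuous, then for every upper semicontinuous function φ on X one has S̃(φ)(x) = inf{μ(φ) : μ ∈ J^S_x} for all x ∈ X; moreover, the function S̃(φ) belongs to S̃. -/
open MeasureTheory Topology Filter Set
open scoped ENNReal Classical

noncomputable section

/-- A convex cone of continuous functions. -/
def IsConvexCone {X : Type*} [TopologicalSpace X] (S : Set C(X, ℝ)) : Prop :=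
  (∀ u ∈ S, ∀ v ∈ S, u + v ∈ S) ∧ (∀ u ∈ S, ∀ c : ℝ, 0 ≤ c → c • u ∈ S)

/-- A measure has compact support. -/
def HasCompactSupportMeas {X : Type*} [TopologicalSpace X] [MeasurableSpace X]
    (μ : Measure X) : Prop :=
  ∃ K : Set X, IsCompact K ∧ μ Kᶜ = 0

/-- The `S`-Jensen measures at `x`: compactly supported regular Borel probability measures `μ`
with `μ(φ) ≥ φ(x)` for all `φ ∈ S`. -/
def JensenMeasures {X : Type*} [TopologicalSpace X] [MeasurableSpace X]
    (S : Set C(X, ℝ)) (x : X) : Set (Measure X) :=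
  {μ | IsProbabilityMeasure μ ∧ μ.Regular ∧ HasCompactSupportMeas μ ∧
      ∀ ψ ∈ S, ψ x ≤ ∫ y, ψ y ∂μ}

/-- The non-negative part of an extended real, as an extended non-negative real. -/
def erealToENNReal (x : EReal) : ℝ≥0∞ := if x = ⊤ then ⊤ else ENNReal.ofReal x.toReal

/-- The integral `μ(φ) ∈ [-∞, ∞]` of an `EReal`-valued function: the (extended) integral of the
positive part minus the (extended) integral of the negative part. -/
def eInt {X : Type*} [MeasurableSpace X] (μ : Measure X) (φ : X → EReal) : EReal :=
  ((∫⁻ y, erealToENNReal (φ y) ∂μ : ℝ≥0∞) : EReal) -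
    ((∫⁻ y, erealToENNReal (-(φ y)) ∂μ : ℝ≥0∞) : EReal)

/-- Lower semicontinuity of a multifunction `J ⊆ X × P(X)` with respect to the weak-* topology:
for every `x`, every `μ ∈ J_x`, and every basic weak-* neighborhood of `μ` (given by finitely
many test functions and `ε > 0`), all points `y` near `x` admit `ν ∈ J_y` in that
neighborhood. -/
def LSCMulti {X : Type*} [TopologicalSpace X] [MeasurableSpace X]
    (J : X → Set (Measure X)) : Prop :=
  ∀ x : X, ∀ μ ∈ J x, ∀ (Φ : Finset C(X, ℝ)) (ε : ℝ), 0 < ε →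
    ∃ W ∈ 𝓝 x, ∀ y ∈ W, ∃ ν ∈ J y, ∀ ψ ∈ Φ, |(∫ z, ψ z ∂ν) - ∫ z, ψ z ∂μ| < ε

/-- The cone `S̃`: upper semicontinuous functions `u : X → [-∞, ∞)` satisfying the subaveraging
inequality `μ(u) ≥ u(x)` for every `x ∈ X` and every `S`-Jensen measure `μ` at `x`. -/
def TildeS {X : Type*} [TopologicalSpace X] [MeasurableSpace X]
    (S : Set C(X, ℝ)) : Set (X → EReal) :=
  {u | UpperSemicontinuous u ∧ (∀ x : X, u x < ⊤) ∧
      ∀ x : X, ∀ μ ∈ JensenMeasures S x, u x ≤ eInt μ u}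

/-- The `S̃`-envelope `S̃(φ)(x) = sup{u(x) : u ∈ S̃, u ≤ φ}`. -/
def TildeSenv {X : Type*} [TopologicalSpace X] [MeasurableSpace X]
    (S : Set C(X, ℝ)) (φ : X → EReal) (x : X) : EReal :=
  ⨆ u ∈ {u ∈ TildeS S | ∀ y, u y ≤ φ y}, u x

theorem erealToENNReal_eq (x : EReal) : erealToENNReal x = x.toENNReal := rfl

theorem eInt_mono {X : Type*} [MeasurableSpace X] (μ : Measure X) {φ φ' : X → EReal}
    (h : ∀ y, φ y ≤ φ' y) : eInt μ φ ≤ eInt μ φ' := by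
  unfold eInt
  refine EReal.sub_le_sub ?_ ?_
  · exact EReal.coe_ennreal_le_coe_ennreal_iff.2
      (lintegral_mono fun y => EReal.toENNReal_le_toENNReal (h y))
  · exact EReal.coe_ennreal_le_coe_ennreal_iff.2
      (lintegral_mono fun y => EReal.toENNReal_le_toENNReal (EReal.neg_le_neg_iff.2 (h y)))

theorem eInt_coe {X : Type*} [MeasurableSpace X] (μ : Measure X) {f : X → ℝ}
    (hf : Integrable f μ) : eInt μ (fun y => (f y : EReal)) = ((∫ y, f y ∂μ : ℝ) : EReal) := by
  have h1 : ∫⁻ y, ENNReal.ofReal (f y) ∂μ ≠ ⊤ := hf.lintegral_lt_top.ne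
  have h2 : ∫⁻ y, ENNReal.ofReal (-f y) ∂μ ≠ ⊤ := hf.neg.lintegral_lt_top.ne
  rw [integral_eq_lintegral_pos_part_sub_lintegral_neg_part hf, EReal.coe_sub,
    EReal.coe_ennreal_toReal h1, EReal.coe_ennreal_toReal h2]
  rfl

theorem integrable_of_cs {X : Type*} [TopologicalSpace X] [T2Space X] [MeasurableSpace X]
    [BorelSpace X] {μ : Measure X} [IsFiniteMeasure μ] (hc : HasCompactSupportMeas μ)
    (f : C(X, ℝ)) : Integrable f μ := by
  obtain ⟨K, hK, h0⟩ := hc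
  obtain ⟨C, hC⟩ := hK.exists_bound_of_continuousOn f.continuous.continuousOn
  refine Integrable.of_bound f.continuous.measurable.aestronglyMeasurable C ?_
  filter_upwards [mem_ae_iff.2 h0] with y hy using hC y hy

theorem exists_cont_above {X : Type*} [TopologicalSpace X] [T2Space X]
    [LocallyCompactSpace X] [SigmaCompactSpace X] [MeasurableSpace X] [BorelSpace X]
    {μ : Measure X} [IsProbabilityMeasure μ] [μ.Regular] (hc : HasCompactSupportMeas μ)
    {φ : X → EReal} (hφ : UpperSemicontinuous φ) (hφtop : ∀ x : X, φ x < ⊤)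
    {c : ℝ} (h : eInt μ φ < c) :
    ∃ ψ : C(X, ℝ), (∀ y, φ y < ψ y) ∧ ∫ y, ψ y ∂μ < c := by
  have hc' := hc
  obtain ⟨K, hK, h0⟩ := hc'
  have hKne : K.Nonempty := by
    rw [nonempty_iff_ne_empty]
    rintro rfl
    simp at h0
  have hφm : Measurable φ := hφ.measurable
  obtain ⟨y0, -, hy0⟩ := (hφ.upperSemicontinuousOn K).exists_isMaxOn hKne hK
  have hae : ∀ᵐ y ∂μ, y ∈ K := mem_ae_iff.2 h0
  let f : ℕ → X → ℝ := fun n y => (max (φ y) ((-(n : ℝ) : ℝ) : EReal)).toReal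
  have hf : ∀ n y, (f n y : EReal) = max (φ y) ((-(n : ℝ) : ℝ) : EReal) := by
    intro n y
    refine EReal.coe_toReal ?_ ?_
    · exact (max_lt (hφtop y) (EReal.coe_lt_top _)).ne
    · exact ((EReal.bot_lt_coe _).trans_le (le_max_right _ _)).ne'
  have hfm : ∀ n, Measurable (f n) := fun n =>
    (hφm.max measurable_const).ereal_toReal
  have hint : ∀ n, Integrable (f n) μ := by
    intro n
    refine Integrable.of_bound (hfm n).aestronglyMeasurable (max |f n y0| n) ?_
    filter_upwards [hae] with y hy
    have h1 : f n y ≤ f n y0 := by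
      rw [← EReal.coe_le_coe_iff, hf, hf]
      exact max_le_max (hy0 hy) le_rfl
    have h2 : -(n : ℝ) ≤ f n y := by
      rw [← EReal.coe_le_coe_iff, hf]
      exact le_max_right _ _
    rw [Real.norm_eq_abs, abs_le]
    constructor
    · have := le_max_right |f n y0| (n : ℝ)
      linarith
    · exact h1.trans ((le_abs_self _).trans (le_max_left _ _))
  have hP : ∀ n, ∫⁻ y, (f n y : EReal).toENNReal ∂μ = ∫⁻ y, (φ y).toENNReal ∂μ := by
    intro n
    refine lintegral_congr fun y => ?_
    rw [hf]
    rcases le_total (φ y) ((-(n : ℝ) : ℝ) : EReal) with h1 | h1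
    · have h3 : ((-(n : ℝ) : ℝ) : EReal) ≤ 0 := by
        exact_mod_cast neg_nonpos.2 (Nat.cast_nonneg n)
      rw [max_eq_right h1, EReal.toENNReal_of_nonpos h3,
        EReal.toENNReal_of_nonpos (h1.trans h3)]
    · rw [max_eq_left h1]
  have hPfin : ∫⁻ y, (φ y).toENNReal ∂μ ≠ ⊤ := by
    rw [← hP 0]
    exact (hint 0).lintegral_lt_top.ne
  have hN : Tendsto (fun n => ∫⁻ y, (-(f n y : EReal)).toENNReal ∂μ) atTop
      (𝓝 (∫⁻ y, (-(φ y)).toENNReal ∂μ)) := by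
    refine lintegral_tendsto_of_tendsto_of_monotone ?_ ?_ ?_
    · intro n
      exact ((hfm n).coe_real_ereal.neg.ereal_toENNReal).aemeasurable
    · refine ae_of_all _ fun y n m hnm => ?_
      refine EReal.toENNReal_le_toENNReal (EReal.neg_le_neg_iff.2 ?_)
      rw [hf, hf]
      refine max_le_max le_rfl ?_
      rw [EReal.coe_le_coe_iff]
      exact neg_le_neg (by exact_mod_cast hnm)
    · refine ae_of_all _ fun y => ?_
      refine (EReal.continuous_toENNReal.tendsto _).comp ?_
      refine (continuous_neg.tendsto _).comp ?_
      simp only [hf]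
      have h1 : Tendsto (fun n : ℕ => ((-(n : ℝ) : ℝ) : EReal)) atTop (𝓝 ⊥) :=
        EReal.tendsto_coe_atBot.comp (tendsto_neg_atTop_atBot.comp tendsto_natCast_atTop_atTop)
      simpa using (tendsto_const_nhds (x := φ y)).max h1
  have hlim : Tendsto (fun n => eInt μ (fun y => (f n y : EReal))) atTop (𝓝 (eInt μ φ)) := by
    have h1 : Tendsto (fun n => ((∫⁻ y, (φ y).toENNReal ∂μ : ℝ≥0∞) : EReal) +
        -((∫⁻ y, (-(f n y : EReal)).toENNReal ∂μ : ℝ≥0∞) : EReal)) atTop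
        (𝓝 (((∫⁻ y, (φ y).toENNReal ∂μ : ℝ≥0∞) : EReal) +
          -((∫⁻ y, (-(φ y)).toENNReal ∂μ : ℝ≥0∞) : EReal))) := by
      have h2 := (continuous_neg.tendsto _).comp
        ((continuous_coe_ennreal_ereal.tendsto _).comp hN)
      refine (EReal.continuousAt_add (p := (_, _)) ?_ ?_).tendsto.comp
        ((tendsto_const_nhds (x := ((∫⁻ y, (φ y).toENNReal ∂μ : ℝ≥0∞) : EReal))).prodMk_nhds h2)
      · left
        simpa using hPfin
      · left
        exact EReal.coe_ennreal_ne_bot _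
    refine h1.congr fun n => ?_
    rw [← hP n]
    rfl
  obtain ⟨n, hn⟩ := (hlim.eventually_lt_const h).exists
  rw [eInt_coe μ (hint n), EReal.coe_lt_coe_iff] at hn
  obtain ⟨g, hfg, hg, hgi, hgt, hgc⟩ :=
    exists_lt_lowerSemicontinuous_integral_lt (f n) (hint n) (sub_pos.2 hn)
  have hsel := exists_continuous_forall_mem_convex_of_local_const
    (t := fun y => {r : ℝ | φ y < r ∧ (r : EReal) < g y}) ?_ ?_
  · obtain ⟨ψ, hψ⟩ := hsel
    refine ⟨ψ, fun y => (hψ y).1, ?_⟩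
    have : ∫ y, ψ y ∂μ ≤ ∫ y, (g y).toReal ∂μ := by
      refine integral_mono_ae (integrable_of_cs hc ψ) hgi ?_
      filter_upwards [hgt] with y hy
      rw [← EReal.coe_le_coe_iff, EReal.coe_toReal hy.ne]
      · exact (hψ y).2.le
      · exact ((EReal.bot_lt_coe _).trans (hψ y).2).ne'
    linarith
  · intro y
    refine Set.OrdConnected.convex ⟨?_⟩
    rintro a ⟨ha, ha'⟩ b ⟨hb, hb'⟩ r ⟨hr1, hr2⟩
    exact ⟨ha.trans_le (EReal.coe_le_coe_iff.2 hr1), (EReal.coe_le_coe_iff.2 hr2).trans_lt hb'⟩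
  · intro y
    obtain ⟨r, hr1, hr2⟩ := EReal.lt_iff_exists_real_btwn.1 (hfg y)
    refine ⟨r, ?_⟩
    have h3 : φ y < r := lt_of_le_of_lt (by rw [hf]; exact le_max_left _ _) hr1
    filter_upwards [hφ y _ h3, hg y _ hr2] with z hz1 hz2 using ⟨hz1, hz2⟩

theorem edwards_compact {X : Type*} [TopologicalSpace X] [T2Space X]
    [MeasurableSpace X] [BorelSpace X]
    {S : Set C(X, ℝ)} (hS : IsConvexCone S)
    (hconst : ∀ c : ℝ, ContinuousMap.const X c ∈ S)
    {L : Set X} (hL : IsCompact L) {x : X} (hx : x ∈ L) (g : C(X, ℝ)) {c : ℝ}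
    (h : ∀ u ∈ S, (∀ y ∈ L, u y ≤ g y) → u x < c) :
    ∃ ν ∈ JensenMeasures S x, ∫ y, g y ∂ν ≤ c := by
  have : CompactSpace L := isCompact_iff_compactSpace.1 hL
  let A : Set C(L, ℝ) := {f | MapsTo f univ (Iio 0)}
  let B : Set C(L, ℝ) := {f | ∃ u ∈ S, ∃ t : ℝ, 0 ≤ t ∧
    f = (u - ContinuousMap.const X (u x) + t • (ContinuousMap.const X c - g)).restrict L}
  have hAo : IsOpen A := ContinuousMap.isOpen_setOfPred_mapsTo isCompact_univ isOpen_Iio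
  have hAc : Convex ℝ A := by
    intro f hf f' hf' a b ha hb hab y hy
    exact (convex_Iio (0 : ℝ)) (hf hy) (hf' hy) ha hb hab
  have hBadd : ∀ f ∈ B, ∀ f' ∈ B, f + f' ∈ B := by
    rintro _ ⟨u, hu, t, ht, rfl⟩ _ ⟨u', hu', t', ht', rfl⟩
    refine ⟨u + u', hS.1 u hu u' hu', t + t', add_nonneg ht ht', ?_⟩
    ext y
    simp
    ring
  have hBsmul : ∀ f ∈ B, ∀ a : ℝ, 0 ≤ a → a • f ∈ B := by
    rintro _ ⟨u, hu, t, ht, rfl⟩ a ha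
    refine ⟨a • u, hS.2 u hu a ha, a * t, mul_nonneg ha ht, ?_⟩
    ext y
    simp
    ring
  have hBc : Convex ℝ B := by
    intro f hf f' hf' a b ha hb hab
    exact hBadd _ (hBsmul f hf a ha) _ (hBsmul f' hf' b hb)
  have hB0 : (0 : C(L, ℝ)) ∈ B := by
    refine ⟨ContinuousMap.const X 0, hconst 0, 0, le_rfl, ?_⟩
    ext y
    simp
  have hdisj : Disjoint A B := by
    rw [Set.disjoint_left]
    rintro _ hA ⟨u, hu, t, ht, rfl⟩
    have hA' : ∀ y ∈ L, u y - u x + t * (c - g y) < 0 := fun y hy => by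
      simpa using hA (mem_univ (⟨y, hy⟩ : L))
    rcases ht.eq_or_lt with rfl | ht
    · have := hA' x hx
      simp at this
    · have h1 := h (t⁻¹ • (u + ContinuousMap.const X (-u x)) + ContinuousMap.const X c)
        (hS.1 _ (hS.2 _ (hS.1 _ hu _ (hconst _)) _ (inv_nonneg.2 ht.le)) _ (hconst c)) ?_
      · simp at h1
      · intro y hy
        have h2 := hA' y hy
        have h3 : t⁻¹ * (u y - u x + t * (c - g y)) < 0 :=
          mul_neg_of_pos_of_neg (inv_pos.2 ht) h2
        have h4 : t⁻¹ * (u y - u x + t * (c - g y)) = t⁻¹ * (u y + - u x) + c - g y := by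
          field_simp
          ring
        simp
        linarith
  obtain ⟨F, s, hFA, hFB⟩ := geometric_hahn_banach_open hAc hAo hBc hdisj
  have hs : s ≤ 0 := by simpa using hFB 0 hB0
  have hFB' : ∀ b ∈ B, 0 ≤ F b := by
    intro b hb
    by_contra hneg
    push Not at hneg
    have h1 := hFB _ (hBsmul b hb ((s - 1) / F b) (div_nonneg_of_nonpos (by linarith) hneg.le))
    rw [map_smul, smul_eq_mul, div_mul_cancel₀ _ hneg.ne] at h1
    linarith
  have hF1 : 0 < F 1 := by
    have h1 : (-1 : C(L, ℝ)) ∈ A := fun y _ => by simp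
    have := hFA _ h1
    rw [map_neg] at this
    linarith
  have hFpos : ∀ f : C(L, ℝ), 0 ≤ f → 0 ≤ F f := by
    intro f hf
    refine le_of_forall_pos_le_add fun ε hε => ?_
    have h1 : (-(f + (ε / F 1) • (1 : C(L, ℝ)))) ∈ A := fun y _ => by
      have h2 : 0 ≤ f y := hf y
      have h3 : 0 < ε / F 1 := div_pos hε hF1
      simp
      linarith
    have := hFA _ h1
    rw [map_neg, map_add, map_smul, smul_eq_mul, div_mul_cancel₀ _ hF1.ne'] at this
    linarith
  let Λ0 : CompactlySupportedContinuousMap L ℝ →ₗ[ℝ] ℝ :=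
    { toFun := fun f => (F 1)⁻¹ * F f.toContinuousMap
      map_add' := fun f f' => by
        have : (f + f').toContinuousMap = f.toContinuousMap + f'.toContinuousMap := rfl
        rw [this, map_add, mul_add]
      map_smul' := fun a f => by
        have : (a • f).toContinuousMap = a • f.toContinuousMap := rfl
        rw [this, map_smul]
        simp
        ring }
  let Λ : CompactlySupportedContinuousMap L ℝ →ₚ[ℝ] ℝ := PositiveLinearMap.mk₀ Λ0
    (fun f hf => mul_nonneg (inv_nonneg.2 hF1.le) (hFpos _ hf))
  let ν' := RealRMK.rieszMeasure Λ
  have hν' : ∀ f : C(L, ℝ), ∫ y, f y ∂ν' = (F 1)⁻¹ * F f := fun f =>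
    RealRMK.integral_rieszMeasure Λ (CompactlySupportedContinuousMap.continuousMapEquiv f)
  have hfin : IsFiniteMeasure ν' := inferInstance
  have : ν'.Regular := RealRMK.regular_rieszMeasure Λ
  have hprob : IsProbabilityMeasure ν' := by
    have h1 := hν' 1
    rw [inv_mul_cancel₀ hF1.ne'] at h1
    simp [measureReal_def] at h1
    exact ⟨(ENNReal.toReal_eq_one_iff _).1 h1⟩
  have hmeas : Measurable (Subtype.val : L → X) := measurable_subtype_coe
  have hmap : ∀ f : C(X, ℝ), ∫ y, f y ∂(ν'.map Subtype.val) = (F 1)⁻¹ * F (f.restrict L) := by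
    intro f
    rw [integral_map hmeas.aemeasurable f.continuous.measurable.aestronglyMeasurable,
      ← hν' (f.restrict L)]
    rfl
  have hpm : IsProbabilityMeasure (ν'.map (Subtype.val : L → X)) :=
    Measure.isProbabilityMeasure_map hmeas.aemeasurable
  have hFc : ∀ a : ℝ, F ((ContinuousMap.const X a).restrict L) = a * F 1 := by
    intro a
    have : (ContinuousMap.const X a).restrict L = a • (1 : C(L, ℝ)) := by
      ext y
      simp
    rw [this, map_smul, smul_eq_mul]
  refine ⟨ν'.map Subtype.val, ⟨hpm, ?_, ⟨L, hL, ?_⟩, ?_⟩, ?_⟩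
  · have : (ν'.map (Subtype.val : L → X)).InnerRegular :=
      Measure.InnerRegular.map_of_continuous continuous_subtype_val
    infer_instance
  · rw [Measure.map_apply hmeas hL.measurableSet.compl]
    simp
  · intro u hu
    rw [hmap]
    have h1 := hFB' ((u - ContinuousMap.const X (u x) +
      (0 : ℝ) • (ContinuousMap.const X c - g)).restrict L) ⟨u, hu, 0, le_rfl, rfl⟩
    have h2 : (u - ContinuousMap.const X (u x) +
      (0 : ℝ) • (ContinuousMap.const X c - g)).restrict L =
      u.restrict L - (ContinuousMap.const X (u x)).restrict L := by
      ext y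
      simp
    rw [h2, map_sub, hFc] at h1
    rw [inv_mul_eq_div, le_div_iff₀ hF1]
    linarith
  · rw [hmap]
    have h1 := hFB' ((ContinuousMap.const X 0 - ContinuousMap.const X ((0 : ℝ)) +
      (1 : ℝ) • (ContinuousMap.const X c - g)).restrict L)
      ⟨_, hconst 0, 1, zero_le_one, rfl⟩
    have h2 : (ContinuousMap.const X 0 - ContinuousMap.const X ((0 : ℝ)) +
      (1 : ℝ) • (ContinuousMap.const X c - g)).restrict L =
      (ContinuousMap.const X c).restrict L - g.restrict L := by
      ext y
      simp
    rw [h2, map_sub, hFc] at h1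
    rw [inv_mul_eq_div, div_le_iff₀ hF1]
    linarith

theorem exhaust_step {X : Type*} [TopologicalSpace X] [T2Space X]
    [LocallyCompactSpace X] [SigmaCompactSpace X] [MeasurableSpace X] [BorelSpace X]
    {S : Set C(X, ℝ)} {x : X} {μ : Measure X} (hμ : μ ∈ JensenMeasures S x)
    {K : Set X} (hK : IsCompact K) (h0 : μ Kᶜ = 0) (g ψ : C(X, ℝ)) {c : ℝ}
    (hψ : ∫ y, ψ y ∂μ < c) (hg : ∀ z ∈ K, ∃ ν ∈ JensenMeasures S z, ∫ y, g y ∂ν < ψ z) :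
    ∃ L : Set X, IsCompact L ∧ x ∈ L ∧ ∀ u ∈ S, (∀ y ∈ L, u y ≤ g y) → u x < c := by
  obtain ⟨hprob, hreg, hcs, hJ⟩ := hμ
  let E : CompactExhaustion X := default
  obtain ⟨n0, hn0⟩ := E.exists_superset_of_isCompact (hK.union (isCompact_singleton (x := x)))
  let h : ℕ → X → ℝ≥0∞ := fun n y =>
    ⨆ u : {u : C(X, ℝ) // u ∈ S ∧ ∀ y ∈ E (n + n0), u y ≤ g y}, ENNReal.ofReal (u.1 y - ψ y)
  have hmeas : ∀ n, Measurable (h n) := by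
    intro n
    refine LowerSemicontinuous.measurable (lowerSemicontinuous_iSup fun u => ?_)
    exact (ENNReal.continuous_ofReal.comp
      (u.1.continuous.sub ψ.continuous)).lowerSemicontinuous
  have hae : ∀ᵐ y ∂μ, y ∈ K := mem_ae_iff.2 h0
  have hsub : ∀ n, K ∪ {x} ⊆ E (n + n0) := fun n =>
    hn0.trans (E.subset (Nat.le_add_left _ _))
  have hlim : Tendsto (fun n => ∫⁻ y, h n y ∂μ) atTop (𝓝 (∫⁻ _, 0 ∂μ)) := by
    refine tendsto_lintegral_of_dominated_convergence (fun y => ENNReal.ofReal ((g - ψ) y))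
      hmeas ?_ ?_ ?_
    · intro n
      filter_upwards [hae] with y hy
      refine iSup_le fun u => ENNReal.ofReal_le_ofReal ?_
      have := u.2.2 y (hsub n (Or.inl hy))
      simp
      linarith
    · exact (integrable_of_cs hcs (g - ψ)).lintegral_lt_top.ne
    · filter_upwards [hae] with y hy
      obtain ⟨ν, ⟨hν1, hν2, hν3, hν4⟩, hν5⟩ := hg y hy
      have hν3' := hν3
      obtain ⟨M, hM, hM0⟩ := hν3'
      obtain ⟨n1, hn1⟩ := E.exists_superset_of_isCompact hM
      refine tendsto_const_nhds.congr' ?_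
      filter_upwards [eventually_ge_atTop n1] with n hn
      symm
      refine le_antisymm (iSup_le fun u => ?_) zero_le
      rw [ENNReal.ofReal_of_nonpos]
      have h1 := hν4 u.1 u.2.1
      have h2 : ∫ y, u.1 y ∂ν ≤ ∫ y, g y ∂ν := by
        refine integral_mono_ae (integrable_of_cs hν3 _) (integrable_of_cs hν3 _) ?_
        filter_upwards [mem_ae_iff.2 hM0] with z hz
        exact u.2.2 z (E.subset (by omega) (hn1 hz))
      linarith
  rw [lintegral_zero] at hlim
  obtain ⟨n, hn⟩ := (hlim.eventually_lt_const (ENNReal.ofReal_pos.2 (sub_pos.2 hψ))).exists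
  refine ⟨E (n + n0), E.isCompact _, hsub n (Or.inr rfl), fun u hu hug => ?_⟩
  have h1 := hJ u hu
  have hi := integrable_of_cs hcs (u - ψ)
  have h2 : ∫ y, (u - ψ) y ∂μ ≤ (∫⁻ y, ENNReal.ofReal ((u - ψ) y) ∂μ).toReal := by
    rw [integral_eq_lintegral_pos_part_sub_lintegral_neg_part hi]
    exact sub_le_self _ ENNReal.toReal_nonneg
  have h3 : ∫⁻ y, ENNReal.ofReal ((u - ψ) y) ∂μ ≤ ∫⁻ y, h n y ∂μ := by
    refine lintegral_mono fun y => ?_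
    exact le_iSup (fun u : {u : C(X, ℝ) // u ∈ S ∧ ∀ y ∈ E (n + n0), u y ≤ g y} =>
      ENNReal.ofReal (u.1 y - ψ y)) ⟨u, hu, hug⟩
  have h4 : (∫⁻ y, ENNReal.ofReal ((u - ψ) y) ∂μ).toReal < c - ∫ y, ψ y ∂μ :=
    (ENNReal.toReal_lt_of_lt_ofReal (h3.trans_lt hn))
  have h5 : ∫ y, (u - ψ) y ∂μ = ∫ y, u y ∂μ - ∫ y, ψ y ∂μ :=
    integral_sub (integrable_of_cs hcs u) (integrable_of_cs hcs ψ)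
  linarith

theorem dirac_mem_jensen {X : Type*} [TopologicalSpace X] [T2Space X]
    [MeasurableSpace X] [BorelSpace X] (S : Set C(X, ℝ)) (x : X) :
    Measure.dirac x ∈ JensenMeasures S x := by
  refine ⟨inferInstance, ?_, ⟨{x}, isCompact_singleton, by simp⟩, fun u _ => by simp⟩
  have : (Measure.dirac x).InnerRegular := by
    refine ⟨fun s hs r hr => ?_⟩
    by_cases hx : x ∈ s
    · refine ⟨{x}, by simpa using hx, isCompact_singleton, ?_⟩
      simpa [hx, Measure.dirac_apply' x hs] using hr
    · simp [hx, Measure.dirac_apply' x hs] at hr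
  infer_instance

theorem eInt_dirac {X : Type*} [MeasurableSpace X] (x : X) {φ : X → EReal}
    (hφ : Measurable φ) : eInt (Measure.dirac x) φ = φ x := by
  unfold eInt
  simp only [erealToENNReal_eq]
  have hφn : Measurable (fun y => -(φ y)) := hφ.neg
  rw [lintegral_dirac' _ hφ.ereal_toENNReal, lintegral_dirac' _ hφn.ereal_toENNReal]
  rcases le_total (φ x) 0 with h | h
  · rw [EReal.toENNReal_of_nonpos h, EReal.coe_toENNReal (by simpa using h)]
    simp
  · rw [EReal.coe_toENNReal h, EReal.toENNReal_of_nonpos (by simpa using h)]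
    simp

theorem lsc_aux {X : Type*} [TopologicalSpace X] [MeasurableSpace X]
    {S : Set C(X, ℝ)} (hJ : LSCMulti (JensenMeasures S)) {x : X} {μ : Measure X}
    (hμ : μ ∈ JensenMeasures S x) (g ψ : C(X, ℝ)) (h : ∫ y, g y ∂μ < ψ x) :
    ∀ᶠ z in 𝓝 x, ∃ ν ∈ JensenMeasures S z, ∫ y, g y ∂ν < ψ z := by
  obtain ⟨W, hW, hW'⟩ := hJ x μ hμ {g} ((ψ x - ∫ y, g y ∂μ) / 2) (by linarith)
  have h1 : ∀ᶠ z in 𝓝 x, (ψ x + ∫ y, g y ∂μ) / 2 < ψ z :=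
    (ψ.continuous.tendsto x).eventually_const_lt (by linarith)
  filter_upwards [hW, h1] with z hz hz1
  obtain ⟨ν, hν, hν'⟩ := hW' z hz
  refine ⟨ν, hν, ?_⟩
  have := (abs_lt.1 (hν' g (by simp))).2
  linarith

/-- Theorem 1.4 (second non-compact version of Edwards' theorem): if `X` is locally compact and
countable at infinity, `S ⊆ C(X)` is a convex cone containing the constants, and the
multifunction `J^S` is lower semicontinuous, then for every upper semicontinuous
`φ : X → [-∞, ∞)` one has `S̃(φ)(x) = inf{μ(φ) : μ ∈ J^S_x}`; moreover `S̃(φ) ∈ S̃`. -/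
theorem noncompact_edwards_usc {X : Type*} [TopologicalSpace X] [T2Space X]
    [LocallyCompactSpace X] [SigmaCompactSpace X] [MeasurableSpace X] [BorelSpace X]
    (S : Set C(X, ℝ)) (hS : IsConvexCone S)
    (hconst : ∀ c : ℝ, ContinuousMap.const X c ∈ S)
    (hJ : LSCMulti (JensenMeasures S))
    (φ : X → EReal) (hφ : UpperSemicontinuous φ) (hφtop : ∀ x : X, φ x < ⊤) :
    (∀ x : X, TildeSenv S φ x = ⨅ μ ∈ JensenMeasures S x, eInt μ φ) ∧
    TildeSenv S φ ∈ TildeS S := by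
  let E : X → EReal := fun x => ⨅ μ ∈ JensenMeasures S x, eInt μ φ
  have hEle : ∀ x, ∀ μ ∈ JensenMeasures S x, E x ≤ eInt μ φ := fun x μ hμ => iInf₂_le μ hμ
  have hEφ : ∀ x, E x ≤ φ x := fun x =>
    (hEle x _ (dirac_mem_jensen S x)).trans_eq (eInt_dirac x hφ.measurable)
  have hEtop : ∀ x, E x < ⊤ := fun x => (hEφ x).trans_lt (hφtop x)
  have hbd : ∀ (g : C(X, ℝ)), (∀ y, φ y < g y) → ∀ z, ∀ ν ∈ JensenMeasures S z,
      E z ≤ ((∫ y, g y ∂ν : ℝ) : EReal) := by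
    intro g hg z ν hν
    have := hν.1
    rw [← eInt_coe ν (integrable_of_cs hν.2.2.1 g)]
    exact (hEle z ν hν).trans (eInt_mono ν fun y => (hg y).le)
  have hex : ∀ x, ∀ c : ℝ, E x < c → ∃ μ ∈ JensenMeasures S x, ∃ g : C(X, ℝ),
      (∀ y, φ y < g y) ∧ ∫ y, g y ∂μ < c := by
    intro x c hc
    obtain ⟨μ, hμ⟩ := iInf_lt_iff.1 hc
    obtain ⟨hμ, hμc⟩ := iInf_lt_iff.1 hμ
    have := hμ.1
    have := hμ.2.1
    exact ⟨μ, hμ, exists_cont_above hμ.2.2.1 hφ hφtop hμc⟩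
  have hEusc : UpperSemicontinuous E := by
    intro x c hc
    obtain ⟨r, hr1, hr2⟩ := EReal.lt_iff_exists_real_btwn.1 hc
    obtain ⟨μ, hμ, g, hg, hgr⟩ := hex x r hr1
    filter_upwards [lsc_aux hJ hμ g (ContinuousMap.const X r) hgr] with z hz
    obtain ⟨ν, hν, hν'⟩ := hz
    refine (hbd g hg z ν hν).trans_lt (lt_trans ?_ hr2)
    exact EReal.coe_lt_coe_iff.2 hν'
  have hEsub : ∀ x, ∀ μ ∈ JensenMeasures S x, E x ≤ eInt μ E := by
    intro x μ hμ
    by_contra hcon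
    push Not at hcon
    obtain ⟨c, hc1, hc2⟩ := EReal.lt_iff_exists_real_btwn.1 hcon
    have hμ' := hμ
    obtain ⟨hprob, hreg, hcs, -⟩ := hμ'
    obtain ⟨ψ, hψ, hψc⟩ := exists_cont_above hcs hEusc hEtop hc1
    obtain ⟨K, hK, h0⟩ := hcs
    have hP : ∃ g : C(X, ℝ), (∀ y, φ y < g y) ∧
        ∀ z ∈ K, ∃ ν ∈ JensenMeasures S z, ∫ y, g y ∂ν < ψ z := by
      refine hK.induction_on (p := fun s => ∃ g : C(X, ℝ), (∀ y, φ y < g y) ∧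
        ∀ z ∈ s, ∃ ν ∈ JensenMeasures S z, ∫ y, g y ∂ν < ψ z) ?_ ?_ ?_ ?_
      · obtain ⟨-, -, g, hg, -⟩ := hex x (ψ x) (hψ x)
        exact ⟨g, hg, by simp⟩
      · rintro s t hst ⟨g, hg, hg'⟩
        exact ⟨g, hg, fun z hz => hg' z (hst hz)⟩
      · rintro s t ⟨g, hg, hg'⟩ ⟨k, hk, hk'⟩
        refine ⟨g ⊓ k, fun y => ?_, ?_⟩
        · rcases le_total (g y) (k y) with h | h
          · simpa [h] using hg y
          · simpa [h] using hk y
        · rintro z (hz | hz)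
          · obtain ⟨ν, hν, hν'⟩ := hg' z hz
            have := hν.1
            refine ⟨ν, hν, lt_of_le_of_lt ?_ hν'⟩
            exact integral_mono (integrable_of_cs hν.2.2.1 _) (integrable_of_cs hν.2.2.1 _)
              (fun y => inf_le_left)
          · obtain ⟨ν, hν, hν'⟩ := hk' z hz
            have := hν.1
            refine ⟨ν, hν, lt_of_le_of_lt ?_ hν'⟩
            exact integral_mono (integrable_of_cs hν.2.2.1 _) (integrable_of_cs hν.2.2.1 _)
              (fun y => inf_le_right)
      · intro y _
        obtain ⟨ν, hν, g, hg, hgr⟩ := hex y (ψ y) (hψ y)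
        have h1 := lsc_aux hJ hν g ψ hgr
        exact ⟨_, mem_nhdsWithin_of_mem_nhds h1, g, hg, fun z hz => hz⟩
    obtain ⟨g, hg, hg'⟩ := hP
    obtain ⟨L, hL, hxL, hLu⟩ := exhaust_step hμ hK h0 g ψ hψc hg'
    obtain ⟨ν, hν, hνc⟩ := edwards_compact hS hconst hL hxL g hLu
    have := (hbd g hg x ν hν).trans (EReal.coe_le_coe_iff.2 hνc)
    exact absurd hc2 (not_lt.2 this)
  have hEmem : E ∈ TildeS S := ⟨hEusc, hEtop, hEsub⟩
  have heq : TildeSenv S φ = E := by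
    funext x
    refine le_antisymm ?_ ?_
    · refine iSup₂_le fun u hu => le_iInf₂ fun μ hμ => ?_
      exact (hu.1.2.2 x μ hμ).trans (eInt_mono μ hu.2)
    · exact le_iSup₂ (f := fun (u : X → EReal) (_ : u ∈ {u ∈ TildeS S | ∀ y, u y ≤ φ y}) => u x)
        E ⟨hEmem, hEφ⟩
  refine ⟨fun x => congrFun heq x, ?_⟩
  rw [heq]
  exact hEmem
end
end

section
/- Let X be a locally compact Hausdorff space countable at infinity and let F : C(X) → [−∞,∞) be a positive superlinear functional such that F(−1) > −∞ (where −1 denotes the constant function). Then F = F' if and only if lim_{j→∞} F(φ_j) = F(φ) for every decreasing sequence φ_j ∈ C(X) converging pointwise to a function φ ∈ C(X). -/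
open MeasureTheory Topology Filter Set
open scoped ENNReal

noncomputable section

/-- A superlinear functional on `C(X)`: positively homogeneous and superadditive. -/
def Superlinear {X : Type*} [TopologicalSpace X] (F : C(X, ℝ) → EReal) : Prop :=
  (∀ φ : C(X, ℝ), ∀ c : ℝ, 0 ≤ c → F (c • φ) = (c : EReal) * F φ) ∧
  (∀ φ₁ φ₂ : C(X, ℝ), F φ₁ + F φ₂ ≤ F (φ₁ + φ₂))

/-- `F*`: compactly supported regular Borel measures `μ` with `μ(φ) ≥ F(φ)` for all `φ`. -/
def FStar {X : Type*} [TopologicalSpace X] [MeasurableSpace X]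
    (F : C(X, ℝ) → EReal) : Set (Measure X) :=
  {μ | μ.Regular ∧ (∃ K : Set X, IsCompact K ∧ μ Kᶜ = 0) ∧
      ∀ φ : C(X, ℝ), F φ ≤ ((∫ y, φ y ∂μ : ℝ) : EReal)}

/-- `F'(φ) = inf{μ(φ) : μ ∈ F*}`. -/
def FPrime {X : Type*} [TopologicalSpace X] [MeasurableSpace X]
    (F : C(X, ℝ) → EReal) (φ : C(X, ℝ)) : EReal :=
  ⨅ μ ∈ FStar F, ((∫ y, φ y ∂μ : ℝ) : EReal)

open scoped CompactlySupported

/-- A positive continuous functional on `C(X)` is a compactly supported regular measure. -/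
lemma exists_measure_of_positive {X : Type*} [TopologicalSpace X] [T2Space X]
    [LocallyCompactSpace X] [MeasurableSpace X] [BorelSpace X]
    (L : C(X, ℝ) →L[ℝ] ℝ) (hL : ∀ φ : C(X, ℝ), 0 ≤ φ → 0 ≤ L φ) :
    ∃ μ : Measure X, μ.Regular ∧ (∃ K : Set X, IsCompact K ∧ μ Kᶜ = 0) ∧
      ∀ φ : C(X, ℝ), ∫ y, φ y ∂μ = L φ := by
  -- the functional only sees a compact set
  obtain ⟨K, hK, hLK⟩ : ∃ K : Set X, IsCompact K ∧
      ∀ φ : C(X, ℝ), (∀ x ∈ K, φ x = 0) → L φ = 0 := by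
    have h1 : ∀ᶠ φ in 𝓝 (0 : C(X, ℝ)), |L φ| < 1 := by
      have : Tendsto (fun φ => |L φ|) (𝓝 0) (𝓝 |L 0|) := (L.continuous.abs).tendsto 0
      rw [map_zero, abs_zero] at this
      exact this.eventually (gt_mem_nhds one_pos)
    obtain ⟨⟨K, V⟩, ⟨hK, hV⟩, hKV⟩ :=
      ((nhds_basis_opens (0 : ℝ)).nhds_continuousMapConst (X := X)).mem_iff.1 h1
    refine ⟨K, hK, fun φ hφ => ?_⟩
    by_contra hne
    have h2 : ((L φ)⁻¹ • φ) ∈ {f : C(X, ℝ) | MapsTo f K V} := by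
      intro x hx
      simpa [hφ x hx] using hV.1
    have h3 : |L ((L φ)⁻¹ • φ)| < 1 := hKV h2
    rw [map_smul, smul_eq_mul, inv_mul_cancel₀ hne] at h3
    simp at h3
  let Λ₀ : C_c(X, ℝ) →ₗ[ℝ] ℝ :=
    { toFun := fun f => L f.toContinuousMap
      map_add' := fun f g => by
        rw [← map_add]; rfl
      map_smul' := fun c f => by
        rw [RingHom.id_apply, ← map_smul]; rfl }
  let Λ : C_c(X, ℝ) →ₚ[ℝ] ℝ := PositiveLinearMap.mk₀ Λ₀ (fun f hf => hL _ hf)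
  have hΛ : ∀ f : C_c(X, ℝ), Λ f = L f.toContinuousMap := fun f => rfl
  have hreg : (RealRMK.rieszMeasure Λ).Regular := by
    unfold RealRMK.rieszMeasure; infer_instance
  have hnull : RealRMK.rieszMeasure Λ Kᶜ = 0 := by
    rw [hK.isClosed.isOpen_compl.measure_eq_iSup_isCompact]
    simp only [ENNReal.iSup_eq_zero]
    intro C hC hCc
    obtain ⟨f, hf1, hf0, hfc, hf⟩ := exists_continuous_one_zero_of_isCompact hCc hK.isClosed
      (Set.disjoint_left.2 fun x hx => hC hx)
    have := RealRMK.rieszMeasure_le_of_eq_one Λ (f := ⟨f, hfc⟩) (fun x => (hf x).1) hCc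
      (fun x hx => hf1 hx)
    rw [hΛ, hLK _ (fun x hx => hf0 hx)] at this
    simpa using this
  refine ⟨RealRMK.rieszMeasure Λ, hreg, ⟨K, hK, hnull⟩, fun φ => ?_⟩
  obtain ⟨f, hf1, -, hfc, hf⟩ := exists_continuous_one_zero_of_isCompact hK isClosed_empty
    (Set.disjoint_empty K)
  let g : C_c(X, ℝ) := ⟨f * φ, hfc.mul_right⟩
  have hg := RealRMK.integral_rieszMeasure Λ g
  have e1 : ∫ x, g x ∂(RealRMK.rieszMeasure Λ) = ∫ x, φ x ∂(RealRMK.rieszMeasure Λ) := by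
    apply integral_congr_ae
    have : ∀ᵐ x ∂(RealRMK.rieszMeasure Λ), x ∈ K := hnull
    filter_upwards [this] with x hx
    change f x * φ x = φ x
    rw [hf1 hx]; simp
  have e2 : L (f * φ - φ) = 0 := hLK _ (fun x hx => by
    have := hf1 hx
    simp only [Pi.one_apply] at this
    simp [this])
  rw [map_sub, sub_eq_zero] at e2
  rw [← e1, hg, hΛ, ← e2]

/-- A convergent sequence in `C(X)` has a subsequence dominated by a decreasing sequence with the
same limit. -/
lemma exists_antitone_majorant {X : Type*} [TopologicalSpace X]
    [LocallyCompactSpace X] [SigmaCompactSpace X] (f : ℕ → C(X, ℝ)) (φ : C(X, ℝ))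
    (hf : Tendsto f atTop (𝓝 φ)) :
    ∃ (σ : ℕ → ℕ) (ψ : ℕ → C(X, ℝ)), StrictMono σ ∧ Antitone ψ ∧ (∀ n, f (σ n) ≤ ψ n) ∧
      ∀ x, Tendsto (fun n => ψ n x) atTop (𝓝 (φ x)) := by
  let E := CompactExhaustion.choice X
  have h1 : ∀ n : ℕ, ∀ᶠ j in atTop, ∀ x ∈ E n, |f j x - φ x| < (1 / 2 : ℝ) ^ n := by
    intro n
    have := (ContinuousMap.tendsto_iff_forall_isCompact_tendstoUniformlyOn.1 hf) (E n)
      (E.isCompact n)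
    rw [Metric.tendstoUniformlyOn_iff] at this
    filter_upwards [this ((1 / 2 : ℝ) ^ n) (by positivity)] with j hj x hx
    have := hj x hx
    rwa [dist_comm, Real.dist_eq] at this
  obtain ⟨σ, hσ, hσ2⟩ := extraction_forall_of_eventually h1
  let g : ℕ → C(X, ℝ) := fun n => |f (σ n) - φ|
  have hg : ∀ n x, g n x = |f (σ n) x - φ x| := fun n x => rfl
  have hg0 : ∀ n x, 0 ≤ g n x := fun n x => abs_nonneg _
  have hsum : Summable g := by
    apply ContinuousMap.summable_of_locally_summable_norm
    intro K
    obtain ⟨m, hm⟩ := E.exists_superset_of_isCompact K.isCompact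
    refine Summable.of_norm_bounded_eventually_nat
      (summable_geometric_of_lt_one (r := (1 / 2 : ℝ)) (by norm_num) (by norm_num)) ?_
    filter_upwards [eventually_ge_atTop m] with n hn
    rw [norm_norm, ContinuousMap.norm_le _ (by positivity)]
    intro x
    have := (hσ2 n x.1 (E.subset hn (hm x.2))).le
    change |g n x.1| ≤ _
    rwa [hg, abs_abs]
  have hs : ∀ n, Summable (fun k => g (k + n)) := fun n => (summable_nat_add_iff n).2 hsum
  have htail : ∀ n x, (∑' k, g (k + n)) x = ∑' k, g (k + n) x := fun n x =>
    ((ContinuousMap.hasSum_apply (hs n).hasSum x).tsum_eq).symm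
  have hsx : ∀ n x, Summable (fun k => g (k + n) x) := fun n x =>
    (ContinuousMap.hasSum_apply (hs n).hasSum x).summable
  have hstep : ∀ n x, (∑' k, g (k + n)) x = g n x + (∑' k, g (k + (n + 1))) x := by
    intro n x
    rw [htail, htail, (hsx n x).tsum_eq_zero_add]
    simp only [zero_add]
    congr 2
    funext k
    congr 2
    ring
  refine ⟨σ, fun n => φ + ∑' k, g (k + n), hσ, antitone_nat_of_succ_le ?_, ?_, ?_⟩
  · intro n x
    have := hstep n x
    have := hg0 n x
    change φ x + (∑' k, g (k + (n + 1))) x ≤ φ x + (∑' k, g (k + n)) x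
    linarith
  · intro n x
    have h2 := hstep n x
    have h3 : 0 ≤ (∑' k, g (k + (n + 1))) x := by
      rw [htail]; exact tsum_nonneg fun k => hg0 _ _
    have h4 := le_abs_self (f (σ n) x - φ x)
    rw [hg] at h2
    change f (σ n) x ≤ φ x + (∑' k, g (k + n)) x
    linarith
  · intro x
    have h5 : Tendsto (fun n => ∑' k, g (k + n) x) atTop (𝓝 0) :=
      tendsto_sum_nat_add (fun k => g k x)
    have h6 := h5.const_add (φ x)
    rw [add_zero] at h6
    simpa only [ContinuousMap.add_apply, htail] using h6

section Aux

variable {X : Type*} [TopologicalSpace X]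
    {F : C(X, ℝ) → EReal} 
    (hpos : ∀ φ : C(X, ℝ), 0 ≤ φ → 0 ≤ F φ) (hsuper : Superlinear F)

lemma Superlinear.zero_eq (hsuper : Superlinear F) : F 0 = 0 := by
  have := hsuper.1 0 0 le_rfl
  simpa using this

lemma Superlinear.monotone (hsuper : Superlinear F)
    (hpos : ∀ φ : C(X, ℝ), 0 ≤ φ → 0 ≤ F φ) {φ ψ : C(X, ℝ)} (h : φ ≤ ψ) : F φ ≤ F ψ := by
  have h1 := hsuper.2 φ (ψ - φ)
  rw [add_sub_cancel] at h1
  refine le_trans ?_ h1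
  calc F φ = F φ + 0 := (add_zero _).symm
    _ ≤ _ := by gcongr; exact hpos _ (sub_nonneg.2 h)

lemma Superlinear.smul_mem (hsuper : Superlinear F) {φ : C(X, ℝ)} {t c : ℝ} (hc : 0 ≤ c)
    (h : (t : EReal) ≤ F φ) : ((c * t : ℝ) : EReal) ≤ F (c • φ) := by
  rw [hsuper.1 φ c hc, EReal.coe_mul]
  exact mul_le_mul_of_nonneg_left h (by exact_mod_cast hc)

lemma Superlinear.separate [LocallyCompactSpace X] [SigmaCompactSpace X]
    (hsuper : Superlinear F) (hpos : ∀ φ : C(X, ℝ), 0 ≤ φ → 0 ≤ F φ)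
    (hcont : ∀ (φs : ℕ → C(X, ℝ)) (φ : C(X, ℝ)), Antitone φs →
      (∀ x : X, Tendsto (fun j => φs j x) atTop (𝓝 (φ x))) →
      Tendsto (fun j => F (φs j)) atTop (𝓝 (F φ)))
    (φ₀ : C(X, ℝ)) (a : ℝ) (ha : F φ₀ < a) :
    ∃ (L : C(X, ℝ) →L[ℝ] ℝ) (r : ℝ), 0 ≤ r ∧
      (∀ (φ : C(X, ℝ)) (t : ℝ), (t : EReal) ≤ F φ → r * t ≤ L φ) ∧ L φ₀ < r * a := by
  let S : Set (C(X, ℝ) × ℝ) := {p | (p.2 : EReal) ≤ F p.1}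
  have hconv : Convex ℝ S := by
    rintro ⟨x, s⟩ hx ⟨y, t⟩ hy a b ha hb -
    have h1 := hsuper.smul_mem ha hx
    have h2 := hsuper.smul_mem hb hy
    change ((a * s + b * t : ℝ) : EReal) ≤ F (a • x + b • y)
    rw [EReal.coe_add]
    exact (add_le_add h1 h2).trans (hsuper.2 _ _)
  have hclosed : IsClosed S := by
    apply IsSeqClosed.isClosed
    intro p q hp hpq
    obtain ⟨σ, ψ, hσ, hanti, hle, hlim⟩ := exists_antitone_majorant (fun n => (p n).1) q.1
      ((continuous_fst.tendsto q).comp hpq)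
    have h1 : Tendsto (fun n => (((p (σ n)).2 : ℝ) : EReal)) atTop (𝓝 (q.2 : EReal)) :=
      ((continuous_coe_real_ereal.comp continuous_snd).tendsto q).comp
        (hpq.comp hσ.tendsto_atTop)
    exact le_of_tendsto_of_tendsto' h1 (hcont ψ q.1 hanti hlim)
      fun n => (hp (σ n)).trans (hsuper.monotone hpos (hle n))
  have hnot : (φ₀, a) ∉ S := fun h => absurd ha (not_lt.2 h)
  obtain ⟨f, u, hfu, hu⟩ := geometric_hahn_banach_closed_point hconv hclosed hnot
  have h0 : (0 : ℝ) < u := by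
    have := hfu (0, 0) (by simp [S, hsuper.zero_eq])
    have e : f ((0 : C(X, ℝ)), (0 : ℝ)) = 0 := map_zero f
    rwa [e] at this
  have hneg : ∀ p ∈ S, f p ≤ 0 := by
    rintro ⟨φ, t⟩ hp
    by_contra! hlt
    have hm : (u / f (φ, t)) • (φ, t) ∈ S := hsuper.smul_mem (by positivity) hp
    have := hfu _ hm
    rw [map_smul, smul_eq_mul, div_mul_cancel₀ _ hlt.ne'] at this
    exact lt_irrefl _ this
  have hdec : ∀ (φ : C(X, ℝ)) (t : ℝ), f (φ, t) = f (φ, 0) + t * f (0, 1) := by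
    intro φ t
    rw [← smul_eq_mul, ← map_smul, ← map_add]
    simp
  refine ⟨-(f.comp (ContinuousLinearMap.inl ℝ C(X, ℝ) ℝ)), f (0, 1), ?_, ?_, ?_⟩
  · have h1 := hneg (0, -1) (by
      change ((-1 : ℝ) : EReal) ≤ F 0
      rw [hsuper.zero_eq]
      exact_mod_cast (by norm_num : (-1 : ℝ) ≤ 0))
    rw [hdec] at h1
    have e : f ((0 : C(X, ℝ)), (0 : ℝ)) = 0 := map_zero f
    linarith
  · intro φ t ht
    have h1 := hneg (φ, t) ht
    rw [hdec] at h1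
    simp only [_root_.neg_apply, ContinuousLinearMap.comp_apply,
      ContinuousLinearMap.inl_apply]
    linarith
  · have h1 := h0.trans hu
    rw [hdec] at h1
    simp only [_root_.neg_apply, ContinuousLinearMap.comp_apply,
      ContinuousLinearMap.inl_apply]
    linarith

lemma Superlinear.separate_one [LocallyCompactSpace X] [SigmaCompactSpace X]
    (hsuper : Superlinear F) (hpos : ∀ φ : C(X, ℝ), 0 ≤ φ → 0 ≤ F φ)
    (hcont : ∀ (φs : ℕ → C(X, ℝ)) (φ : C(X, ℝ)), Antitone φs →
      (∀ x : X, Tendsto (fun j => φs j x) atTop (𝓝 (φ x))) →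
      Tendsto (fun j => F (φs j)) atTop (𝓝 (F φ)))
    (φ₀ : C(X, ℝ)) (a : ℝ) (ha : F φ₀ < a) :
    ∃ (L : C(X, ℝ) →L[ℝ] ℝ),
      (∀ (φ : C(X, ℝ)) (t : ℝ), (t : EReal) ≤ F φ → t ≤ L φ) ∧ L φ₀ < a := by
  have key : ∀ (φ₀ : C(X, ℝ)) (a : ℝ) (L : C(X, ℝ) →L[ℝ] ℝ) (r : ℝ), 0 < r →
      (∀ (φ : C(X, ℝ)) (t : ℝ), (t : EReal) ≤ F φ → r * t ≤ L φ) → L φ₀ < r * a →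
      ∃ (L : C(X, ℝ) →L[ℝ] ℝ),
      (∀ (φ : C(X, ℝ)) (t : ℝ), (t : EReal) ≤ F φ → t ≤ L φ) ∧ L φ₀ < a := by
    intro φ₀ a L r hr h1 h2
    refine ⟨r⁻¹ • L, fun φ t ht => ?_, ?_⟩
    · change t ≤ r⁻¹ * L φ
      rw [le_inv_mul_iff₀ hr]
      exact h1 φ t ht
    · change r⁻¹ * L φ₀ < a
      rw [inv_mul_lt_iff₀ hr]
      exact h2
  obtain ⟨L, r, hr, h1, h2⟩ := hsuper.separate hpos hcont φ₀ a ha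
  rcases hr.eq_or_lt with rfl | hr
  · obtain ⟨L', r', hr', h1', h2'⟩ := hsuper.separate hpos hcont 0 1 (by
      rw [hsuper.zero_eq]; exact_mod_cast one_pos)
    rw [map_zero, mul_one] at h2'
    obtain ⟨M, hM, -⟩ := key 0 1 L' r' h2' h1' (by rw [map_zero]; linarith)
    simp only [zero_mul] at h1 h2
    have hk : 0 ≤ (|M φ₀ - a| + 1) / (-L φ₀) := div_nonneg (by positivity) (by linarith)
    refine ⟨M + ((|M φ₀ - a| + 1) / (-L φ₀)) • L, fun φ t ht => ?_, ?_⟩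
    · change t ≤ M φ + (|M φ₀ - a| + 1) / (-L φ₀) * L φ
      have := mul_nonneg hk (h1 φ t ht)
      linarith [hM φ t ht]
    · change M φ₀ + (|M φ₀ - a| + 1) / (-L φ₀) * L φ₀ < a
      have e : (|M φ₀ - a| + 1) / (-L φ₀) * L φ₀ = -(|M φ₀ - a| + 1) := by
        have := h2.ne
        field_simp
      rw [e]
      linarith [le_abs_self (M φ₀ - a)]
  · exact key φ₀ a L r hr h1 h2

end Aux

/-- Theorem 2.5: let `X` be a locally compact Hausdorff space countable at infinity and `F` a
positive superlinear functional on `C(X)` with `F(-1) > -∞`. Then `F = F'` if and only if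
`lim F(φ_j) = F(φ)` for every decreasing sequence `φ_j ∈ C(X)` converging pointwise to
`φ ∈ C(X)`. -/
theorem eq_FPrime_iff_decreasing_continuity {X : Type*} [TopologicalSpace X] [T2Space X]
    [LocallyCompactSpace X] [SigmaCompactSpace X] [MeasurableSpace X] [BorelSpace X]
    (F : C(X, ℝ) → EReal) (hF : ∀ φ : C(X, ℝ), F φ < ⊤)
    (hpos : ∀ φ : C(X, ℝ), 0 ≤ φ → 0 ≤ F φ) (hsuper : Superlinear F)
    (hbot : F (ContinuousMap.const X (-1)) ≠ ⊥) :
    (∀ φ : C(X, ℝ), F φ = FPrime F φ) ↔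
    (∀ (φs : ℕ → C(X, ℝ)) (φ : C(X, ℝ)), Antitone φs →
      (∀ x : X, Tendsto (fun j => φs j x) atTop (𝓝 (φ x))) →
      Tendsto (fun j => F (φs j)) atTop (𝓝 (F φ))) := by
  constructor
  · intro h φs φ hanti hlim
    have hmono : ∀ j, F φ ≤ F (φs j) := fun j => by
      refine hsuper.monotone hpos fun x => ?_
      have hx : Antitone fun j => φs j x := fun i k hik => hanti hik x
      exact hx.le_of_tendsto (hlim x) j
    refine tendsto_order.2 ⟨fun b hb => Eventually.of_forall fun j => hb.trans_le (hmono j),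
      fun b hb => ?_⟩
    rw [h φ] at hb
    simp only [FPrime, iInf_lt_iff] at hb
    obtain ⟨μ, hμ, hb⟩ := hb
    obtain ⟨hreg, ⟨K, hK, hKc⟩, hle⟩ := hμ
    have hrestr : μ.restrict K = μ := Measure.restrict_eq_self_of_ae_mem hKc
    have hint : ∀ ψ : C(X, ℝ), Integrable (fun x => ψ x) μ := by
      intro ψ
      have := ψ.continuous.continuousOn.integrableOn_compact (μ := μ) hK
      rwa [IntegrableOn, hrestr] at this
    have h1 : Tendsto (fun j => ∫ x, φs j x ∂μ) atTop (𝓝 (∫ x, φ x ∂μ)) :=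
      integral_tendsto_of_tendsto_of_antitone (fun j => hint _) (hint φ)
        (Eventually.of_forall fun x i k hik => hanti hik x) (Eventually.of_forall hlim)
    have h2 := (continuous_coe_real_ereal.tendsto _).comp h1
    filter_upwards [h2.eventually (gt_mem_nhds hb)] with j hj
    exact (hle _).trans_lt hj
  · intro hcont φ
    apply le_antisymm
    · exact le_iInf₂ fun μ hμ => hμ.2.2 φ
    · refine EReal.le_of_forall_lt_iff_le.1 fun a ha => ?_
      obtain ⟨L, hL, hLa⟩ := hsuper.separate_one hpos hcont φ a ha
      obtain ⟨μ, hreg, hK, hμ⟩ := exists_measure_of_positive L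
        (fun ψ hψ => hL ψ 0 (by exact_mod_cast hpos ψ hψ))
      have hmem : μ ∈ FStar F := by
        refine ⟨hreg, hK, fun ψ => ?_⟩
        rw [hμ]
        refine EReal.ge_of_forall_gt_iff_ge.1 fun t ht => ?_
        exact_mod_cast hL ψ t ht.le
      refine (iInf₂_le μ hmem).trans ?_
      rw [hμ]
      exact_mod_cast hLa.le
end
end

section
/- Let X be a locally compact Hausdorff space countable at infinity. If F is a positive linear functional on C(X), then there is a compact set K ⊆ X such that F(φ) = 0 whenever φ ∈ C(X) vanishes identically on K. -/
/-- Lemma 2.2: on a locally compact Hausdorff space countable at infinity, every positive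
linear functional on `C(X)` is supported on a compact set: there is a compact `K ⊆ X` such
that `F φ = 0` whenever `φ` vanishes identically on `K`. -/
theorem positive_linear_functional_compact_support {X : Type*} [TopologicalSpace X] [T2Space X]
    [LocallyCompactSpace X] [SigmaCompactSpace X]
    (F : C(X, ℝ) →ₗ[ℝ] ℝ) (hpos : ∀ φ : C(X, ℝ), 0 ≤ φ → 0 ≤ F φ) :
    ∃ K : Set X, IsCompact K ∧ ∀ φ : C(X, ℝ), (∀ x ∈ K, φ x = 0) → F φ = 0 := by
  by_contra hcon
  push Not at hcon
  have hmono : ∀ f g : C(X, ℝ), (∀ x, f x ≤ g x) → F f ≤ F g := by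
    intro f g h
    have := hpos (g - f) (fun x => by simpa using h x)
    rw [map_sub] at this
    linarith
  let K := CompactExhaustion.choice X
  have key : ∀ n, ∃ ψ : C(X, ℝ), (∀ x, 0 ≤ ψ x) ∧ (∀ x ∈ K n, ψ x = 0) ∧ F ψ = 1 := by
    intro n
    obtain ⟨φ, h0, hne⟩ := hcon (K n) (K.isCompact n)
    let a : C(X, ℝ) := ⟨fun x => |φ x|, by fun_prop⟩
    have h1 : F φ ≤ F a := hmono _ _ (fun x => le_abs_self _)
    have h2 : F (-φ) ≤ F a := hmono _ _ (fun x => neg_le_abs _)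
    rw [map_neg] at h2
    have hp : 0 < F a := by
      rcases lt_or_gt_of_ne hne with h | h <;> linarith
    refine ⟨(F a)⁻¹ • a, fun x => ?_, fun x hx => ?_, ?_⟩
    · exact mul_nonneg (inv_nonneg.2 hp.le) (abs_nonneg (φ x))
    · change (F a)⁻¹ * |φ x| = 0
      simp [h0 x hx]
    · rw [map_smul, smul_eq_mul, inv_mul_cancel₀ hp.ne']
  choose ψ hψ0 hψK hψF using key
  have hsub : ∀ m, ∀ x ∈ K m, ∀ n, ψ n x ≠ 0 → n < m := by
    intro m x hx n hn
    by_contra h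
    exact hn (hψK n x (K.subset (not_lt.1 h) hx))
  have hlf : LocallyFinite fun n => Function.support (ψ n) := by
    intro x
    obtain ⟨m, hm⟩ := K.exists_mem_nhds x
    refine ⟨K m, hm, (Set.finite_lt_nat m).subset ?_⟩
    rintro n ⟨y, hy, hyK⟩
    exact hsub m y hyK n hy
  let Ψ : C(X, ℝ) := ⟨fun x => ∑ᶠ n, ψ n x, continuous_finsum (fun n => (ψ n).continuous) hlf⟩
  have hbound : ∀ N : ℕ, (N : ℝ) ≤ F Ψ := by
    intro N
    have h1 : F (∑ n ∈ Finset.range N, ψ n) = N := by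
      rw [map_sum]
      simp [hψF]
    rw [← h1]
    apply hmono
    intro x
    obtain ⟨m, hm⟩ := K.exists_mem x
    have h2 : Ψ x = ∑ n ∈ Finset.range (max N m), ψ n x := by
      apply finsum_eq_sum_of_support_subset
      intro n hn
      have := hsub m x hm n hn
      simp [this]
    rw [h2, ContinuousMap.sum_apply]
    exact Finset.sum_le_sum_of_subset_of_nonneg
      (Finset.range_mono (le_max_left _ _)) (fun n _ _ => hψ0 n x)
  obtain ⟨N, hN⟩ := exists_nat_gt (F Ψ)
  exact absurd (hbound N) (not_le.2 hN)
end

section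
/- Let X be a locally compact Hausdorff space countable at infinity. If F is a positive linear functional on C(X), then F is continuous (F ∈ C*(X)) and there is a regular Borel measure μ on X with compact support such that F(φ) = ∫_X φ dμ for every φ ∈ C(X). -/
open MeasureTheory
open scoped CompactlySupported


/-- The functional lives on a compact set. -/
lemma plf_exists_compact {X : Type*} [TopologicalSpace X] [T2Space X]
    [LocallyCompactSpace X] [SigmaCompactSpace X]
    (F : C(X, ℝ) →ₗ[ℝ] ℝ) (hpos : ∀ φ : C(X, ℝ), 0 ≤ φ → 0 ≤ F φ) :
    ∃ K : Set X, IsCompact K ∧ ∀ φ : C(X, ℝ), 0 ≤ φ → (∀ x ∈ K, φ x = 0) → F φ = 0 := by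
  by_contra! hcon
  let E : CompactExhaustion X := default
  choose φ hφ0 hφK hφF using fun n => hcon (E n) (E.isCompact n)
  have hFpos : ∀ n, 0 < F (φ n) := fun n => lt_of_le_of_ne (hpos _ (hφ0 n)) (hφF n).symm
  let ψ : ℕ → C(X, ℝ) := fun n => (F (φ n))⁻¹ • φ n
  have hψF : ∀ n, F (ψ n) = 1 := fun n => by
    simp [ψ, (hFpos n).ne']
  have hψ0 : ∀ n x, 0 ≤ ψ n x := fun n x => by
    have h1 : 0 ≤ φ n x := hφ0 n x
    have h2 := (hFpos n).le
    simp only [ψ, ContinuousMap.smul_apply, smul_eq_mul]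
    positivity
  have hψK : ∀ n, ∀ x ∈ E n, ψ n x = 0 := fun n x hx => by
    simp [ψ, hφK n x hx]
  have hlf : LocallyFinite fun n => Function.support (ψ n) := by
    intro x
    obtain ⟨m, hm⟩ := E.exists_mem_nhds x
    refine ⟨E m, hm, (Set.finite_lt_nat m).subset ?_⟩
    rintro n ⟨y, hy, hym⟩
    by_contra hnm
    exact hy (hψK n y (E.subset (not_lt.1 hnm) hym))
  let Φ : C(X, ℝ) := ⟨fun x => ∑ᶠ n, ψ n x, continuous_finsum (fun n => (ψ n).continuous) hlf⟩
  have key : ∀ N : ℕ, (N : ℝ) ≤ F Φ := by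
    intro N
    have h : 0 ≤ F (Φ - ∑ n ∈ Finset.range N, ψ n) := by
      apply hpos
      intro x
      have hfin : (Function.support fun n => ψ n x).Finite := hlf.point_finite x
      have : ∑ n ∈ Finset.range N, ψ n x ≤ ∑ᶠ n, ψ n x := by
        rw [finsum_eq_sum_of_support_subset (s := hfin.toFinset ∪ Finset.range N)]
        · exact Finset.sum_le_sum_of_subset_of_nonneg Finset.subset_union_right
            (fun i _ _ => hψ0 i x)
        · intro n hn
          simp only [Finset.coe_union, Set.Finite.coe_toFinset]
          exact Or.inl hn
      simpa [Φ] using this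
    rw [map_sub, map_sum] at h
    simpa [hψF] using h
  obtain ⟨N, hN⟩ := exists_nat_gt (F Φ)
  exact absurd (key N) (not_le.2 hN)

lemma plf_eq_of_eqOn {X : Type*} [TopologicalSpace X]
    (F : C(X, ℝ) →ₗ[ℝ] ℝ) (hpos : ∀ φ : C(X, ℝ), 0 ≤ φ → 0 ≤ F φ) (K : Set X)
    (hK : ∀ φ : C(X, ℝ), 0 ≤ φ → (∀ x ∈ K, φ x = 0) → F φ = 0)
    (φ ψ : C(X, ℝ)) (h : ∀ x ∈ K, φ x = ψ x) : F φ = F ψ := by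
  have h0 : F |φ - ψ| = 0 := hK _ (abs_nonneg _) (fun x hx => by simp [h x hx])
  have h1 := hpos (|φ - ψ| - (φ - ψ)) (sub_nonneg.2 (le_abs_self _))
  have h2 := hpos (|φ - ψ| - -(φ - ψ)) (sub_nonneg.2 (neg_le_abs _))
  simp only [map_sub, map_neg] at h1 h2
  linarith



/-- Proposition 2.3: on a locally compact Hausdorff space countable at infinity, every positive
linear functional `F` on `C(X)` (with the topology of uniform convergence on compacta, i.e. the
compact-open topology) is continuous, and is represented by a compactly supported regular Borel
measure: `F φ = ∫ φ dμ` for all `φ ∈ C(X)`. -/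
theorem positive_linear_functional_is_measure {X : Type*} [TopologicalSpace X] [T2Space X]
    [LocallyCompactSpace X] [SigmaCompactSpace X] [MeasurableSpace X] [BorelSpace X]
    (F : C(X, ℝ) →ₗ[ℝ] ℝ) (hpos : ∀ φ : C(X, ℝ), 0 ≤ φ → 0 ≤ F φ) :
    Continuous F ∧
    ∃ μ : Measure X, μ.Regular ∧ (∃ K : Set X, IsCompact K ∧ μ Kᶜ = 0) ∧
      ∀ φ : C(X, ℝ), F φ = ∫ y, φ y ∂μ := by

  obtain ⟨K, hKc, hK⟩ := plf_exists_compact F hpos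
  have heq := plf_eq_of_eqOn F hpos K hK
  refine ⟨?_, ?_⟩
  · have hbound : ∀ (M : ℝ), 0 ≤ M → ∀ φ : C(X, ℝ), (∀ x ∈ K, |φ x| ≤ M) → |F φ| ≤ M * F 1 := by
      intro M hM φ hφ
      have hc : F φ = F ((φ ⊓ M • 1) ⊔ (-(M • 1))) := by
        apply heq
        intro x hx
        have := abs_le.1 (hφ x hx)
        simp [this.1, this.2]
      rw [hc]
      have h1 := hpos (M • 1 - ((φ ⊓ M • 1) ⊔ (-(M • 1)))) (by
        rw [sub_nonneg]
        refine sup_le inf_le_right ?_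
        intro x
        simp
        linarith)
      have h2 := hpos (((φ ⊓ M • 1) ⊔ (-(M • 1))) - (-(M • 1))) (by
        rw [sub_nonneg]
        exact le_sup_right)
      simp only [map_sub, map_neg, map_smul, smul_eq_mul] at h1 h2
      rw [abs_le]
      constructor <;> linarith
    have hF1 : 0 ≤ F 1 := hpos 1 zero_le_one
    apply continuous_of_continuousAt_zero F
    rw [ContinuousAt, map_zero, Metric.tendsto_nhds]
    intro ε hε
    have hδ : 0 < ε / (F 1 + 1) := by positivity
    have hev := (ContinuousMap.tendsto_iff_forall_isCompact_tendstoUniformlyOn.1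
      (Filter.tendsto_id (x := nhds (0 : C(X, ℝ))))) K hKc
    rw [Metric.tendstoUniformlyOn_iff] at hev
    filter_upwards [hev _ hδ] with φ hφ
    have := hbound _ hδ.le φ (fun x hx => by
      have := hφ x hx
      simp at this
      exact this.le)
    rw [Real.dist_eq, sub_zero]
    refine this.trans_lt ?_
    rw [div_mul_eq_mul_div, div_lt_iff₀ (by positivity)]
    nlinarith
  · let Λ : C_c(X, ℝ) →ₚ[ℝ] ℝ := PositiveLinearMap.mk₀
      { toFun := fun f => F f.toContinuousMap
        map_add' := fun f g => F.map_add f.toContinuousMap g.toContinuousMap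
        map_smul' := fun c f => F.map_smul c f.toContinuousMap }
      (fun f hf => hpos f.toContinuousMap hf)
    have hΛ : ∀ f : C_c(X, ℝ), Λ f = F f.toContinuousMap := fun f => rfl
    have hμK : RealRMK.rieszMeasure Λ Kᶜ = 0 := by
      rw [hKc.isClosed.isOpen_compl.measure_eq_iSup_isCompact]
      simp only [ENNReal.iSup_eq_zero]
      intro L hLK hL
      obtain ⟨f, hf1, hf0, hfc, hf⟩ := exists_continuous_one_zero_of_isCompact hL hKc.isClosed
        (Set.disjoint_left.2 fun x hx => hLK hx)
      have := RealRMK.rieszMeasure_le_of_eq_one Λ (f := ⟨f, hfc⟩) (fun x => (hf x).1) hL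
        (fun x hx => hf1 hx)
      rw [hΛ, hK f (fun x => (hf x).1) (fun x hx => hf0 hx)] at this
      simpa using this
    refine ⟨RealRMK.rieszMeasure Λ, inferInstance, ⟨K, hKc, hμK⟩, fun φ => ?_⟩
    obtain ⟨χ, hχ1, -, hχc, -⟩ := exists_continuous_one_zero_of_isCompact hKc isClosed_empty
      (Set.disjoint_empty K)
    have h1 : F φ = F (χ * φ) := heq _ _ fun x hx => by simp [hχ1 hx]
    have h2 := RealRMK.integral_rieszMeasure Λ ⟨χ * φ, hχc.mul_right⟩
    rw [h1, ← hΛ ⟨χ * φ, hχc.mul_right⟩, ← h2]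
    apply integral_congr_ae
    have : ∀ᵐ x ∂(RealRMK.rieszMeasure Λ), x ∈ K := hμK
    filter_upwards [this] with x hx
    simp [hχ1 hx]
end

section
/- Let X be a locally compact Hausdorff space countable at infinity. Let φ be a locally bounded above function on X, let U be an open set in X, and let ψ be a continuous function on U with ψ ≥ φ on U. Then for every compact set K ⊆ U there is a function f ∈ C(X) such that f ≥ φ on X and f = ψ on K. -/
open Topology Set

/-- Lemma 4.1: let `X` be a locally compact Hausdorff space countable at infinity, `φ` a locally
bounded above function on `X`, `U` open, and `ψ` continuous on `U` with `ψ ≥ φ` on `U`. Then for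
every compact `K ⊆ U` there is `f ∈ C(X)` with `f ≥ φ` on `X` and `f = ψ` on `K`. -/
theorem continuous_majorant_extension {X : Type*} [TopologicalSpace X] [T2Space X]
    [LocallyCompactSpace X] [SigmaCompactSpace X]
    (φ : X → ℝ) (hφ : ∀ x : X, ∃ V ∈ 𝓝 x, BddAbove (φ '' V))
    (U : Set X) (hU : IsOpen U)
    (ψ : X → ℝ) (hψ : ContinuousOn ψ U) (hψφ : ∀ x ∈ U, φ x ≤ ψ x)
    (K : Set X) (hK : IsCompact K) (hKU : K ⊆ U) :
    ∃ f : C(X, ℝ), (∀ x : X, φ x ≤ f x) ∧ ∀ x ∈ K, f x = ψ x := by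
  have key := exists_continuous_forall_mem_convex_of_local (X := X) (E := ℝ)
    (t := fun x => {y : ℝ | φ x ≤ y ∧ (x ∈ K → y = ψ x)}) ?_ ?_
  · obtain ⟨g, hg⟩ := key
    exact ⟨g, fun x => (hg x).1, fun x hx => (hg x).2 hx⟩
  · intro x
    by_cases hx : x ∈ K
    · have h : {y : ℝ | φ x ≤ y ∧ (x ∈ K → y = ψ x)} = {ψ x} := by
        ext y
        simp only [mem_setOf_eq, mem_singleton_iff]
        exact ⟨fun h => h.2 hx, fun h => ⟨h ▸ hψφ x (hKU hx), fun _ => h⟩⟩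
      rw [h]
      exact convex_singleton _
    · have h : {y : ℝ | φ x ≤ y ∧ (x ∈ K → y = ψ x)} = Ici (φ x) := by
        ext y
        simp [hx]
      rw [h]
      exact convex_Ici _
  · intro x
    by_cases hx : x ∈ K
    · exact ⟨U, hU.mem_nhds (hKU hx), ψ, hψ, fun y hy => ⟨hψφ y hy, fun _ => rfl⟩⟩
    · obtain ⟨V, hV, c, hc⟩ := hφ x
      refine ⟨V ∩ Kᶜ, Filter.inter_mem hV (hK.isClosed.isOpen_compl.mem_nhds hx), fun _ => c,
        continuousOn_const, fun y hy => ⟨hc (mem_image_of_mem φ hy.1), fun h => absurd h hy.2⟩⟩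
end

section
/- Let X be a locally compact Hausdorff space countable at infinity and let φ be a locally bounded above real-valued function on X. Then φ₁* = φ₂*, i.e. for every x ∈ X the infimum of ψ(x) over all continuous functions ψ ∈ C(X) with ψ ≥ φ equals inf{sup_{y∈U} φ(y) : U open, x ∈ U}. -/
open Topology Set

/-- Corollary 4.2: for a locally bounded above function `φ` on a locally compact Hausdorff space
countable at infinity, the two upper regularizations coincide:
`inf{ψ(x) : ψ ∈ C(X), ψ ≥ φ} = inf{sup_{y ∈ U} φ(y) : U open, x ∈ U}`. -/
theorem upper_regularizations_coincide {X : Type*} [TopologicalSpace X] [T2Space X]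
    [LocallyCompactSpace X] [SigmaCompactSpace X]
    (φ : X → ℝ) (hφ : ∀ x : X, ∃ V ∈ 𝓝 x, BddAbove (φ '' V)) :
    ∀ x : X,
      (⨅ ψ ∈ {ψ : C(X, ℝ) | ∀ y, φ y ≤ ψ y}, ((ψ x : ℝ) : EReal)) =
      ⨅ U ∈ {U : Set X | IsOpen U ∧ x ∈ U}, ⨆ y ∈ U, ((φ y : ℝ) : EReal) := by
  intro x
  apply le_antisymm
  · refine le_iInf₂ fun U hU => ?_
    obtain ⟨hUo, hxU⟩ := hU
    rw [← EReal.le_of_forall_lt_iff_le]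
    intro c hc
    have hcU : ∀ y ∈ U, φ y ≤ c := fun y hy => by
      have h1 : ((φ y : ℝ) : EReal) ≤ ⨆ y ∈ U, ((φ y : ℝ) : EReal) :=
        le_iSup₂ (f := fun y (_ : y ∈ U) => ((φ y : ℝ) : EReal)) y hy
      exact EReal.coe_le_coe_iff.1 (h1.trans hc.le)
    obtain ⟨g, hg⟩ := exists_continuous_forall_mem_convex_of_local_const
      (t := fun y => {v : ℝ | φ y ≤ v ∧ (y = x → v ≤ c)}) (by
        intro y
        by_cases h : y = x
        · simp only [h, true_imp_iff]; exact convex_Icc (φ x) c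
        · simp only [h, false_imp_iff, and_true]; exact convex_Ici (φ y)) (by
        intro z
        by_cases h : z = x
        · subst h
          refine ⟨c, ?_⟩
          filter_upwards [hUo.mem_nhds hxU] with y hy
          exact ⟨hcU y hy, fun _ => le_rfl⟩
        · obtain ⟨V, hV, b, hb⟩ := hφ z
          refine ⟨b, ?_⟩
          filter_upwards [hV, isOpen_ne.mem_nhds h] with y hy hyx
          exact ⟨hb (mem_image_of_mem _ hy), fun e => absurd e hyx⟩)
    refine (iInf₂_le g (fun y => (hg y).1)).trans ?_
    exact EReal.coe_le_coe_iff.2 ((hg x).2 rfl)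
  · refine le_iInf₂ fun ψ hψ => ?_
    rw [← EReal.le_of_forall_lt_iff_le]
    intro c hc
    have hc' : ψ x < c := EReal.coe_lt_coe_iff.1 hc
    refine (iInf₂_le {y | ψ y < c} ⟨isOpen_lt ψ.continuous continuous_const, hc'⟩).trans ?_
    refine iSup₂_le fun y hy => ?_
    exact EReal.coe_le_coe_iff.2 ((hψ y).trans (le_of_lt hy))
end

section
/- Let X be a locally compact Hausdorff space countable at infinity and let S ⊆ C(X) be a convex cone containing the constant functions. For x ∈ X let S*_x denote the set of regular Borel measures μ on X with compact support such that μ(ψ) ≥ S(ψ)(x) for every ψ ∈ C(X). Then S*_x = J^S_x for every x ∈ X. -/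
open MeasureTheory Topology Filter Set
open scoped ENNReal

noncomputable section

/-- The `S`-envelope `S(φ)(x) = sup{u(x) : u ∈ S, u ≤ φ}`, equal to `⊥ = -∞` if no
`u ∈ S` lies below `φ`. -/
def Senv {X : Type*} [TopologicalSpace X] (S : Set C(X, ℝ)) (φ : X → ℝ) (x : X) : EReal :=
  ⨆ u ∈ {u ∈ S | ∀ y, u y ≤ φ y}, ((u x : ℝ) : EReal)

/-- `S*_x`: compactly supported regular Borel measures `μ` with `μ(ψ) ≥ S(ψ)(x)` for every
`ψ ∈ C(X)`. -/
def SStar {X : Type*} [TopologicalSpace X] [MeasurableSpace X]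
    (S : Set C(X, ℝ)) (x : X) : Set (Measure X) :=
  {μ | μ.Regular ∧ HasCompactSupportMeas μ ∧
      ∀ ψ : C(X, ℝ), Senv S ⇑ψ x ≤ ((∫ y, ψ y ∂μ : ℝ) : EReal)}

/-- In the proof of Theorem 1.3: for a convex cone `S ⊆ C(X)` containing the constants on a
locally compact Hausdorff space countable at infinity, `S*_x = J^S_x` for every `x ∈ X`. -/
theorem SStar_eq_JensenMeasures {X : Type*} [TopologicalSpace X] [T2Space X]
    [LocallyCompactSpace X] [SigmaCompactSpace X] [MeasurableSpace X] [BorelSpace X]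
    (S : Set C(X, ℝ)) (hS : IsConvexCone S)
    (hconst : ∀ c : ℝ, ContinuousMap.const X c ∈ S) :
    ∀ x : X, SStar S x = JensenMeasures S x := by
  have hint : ∀ (μ : Measure X), IsFiniteMeasureOnCompacts μ → HasCompactSupportMeas μ →
      ∀ ψ : C(X, ℝ), Integrable (fun y => ψ y) μ := by
    rintro μ hμ ⟨K, hK, hK0⟩ ψ
    have h1 : IntegrableOn (fun y => ψ y) K μ := ψ.continuous.continuousOn.integrableOn_compact hK
    have h2 : IntegrableOn (fun y => ψ y) Kᶜ μ := by
      rw [IntegrableOn, Measure.restrict_eq_zero.2 hK0]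
      exact integrable_zero_measure
    have h3 := h1.union h2
    rwa [union_compl_self, integrableOn_univ] at h3
  intro x
  ext μ
  constructor
  · rintro ⟨hreg, hcs, h⟩
    have key : ∀ ψ ∈ S, ψ x ≤ ∫ y, ψ y ∂μ := by
      intro ψ hψ
      have h1 : ((ψ x : ℝ) : EReal) ≤ Senv S ⇑ψ x :=
        le_iSup₂_of_le (f := fun (u : C(X, ℝ)) (_ : u ∈ {u ∈ S | ∀ y, u y ≤ ψ y}) =>
          ((u x : ℝ) : EReal)) ψ ⟨hψ, fun _ => le_rfl⟩ le_rfl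
      exact EReal.coe_le_coe_iff.1 (h1.trans (h ψ))
    refine ⟨?_, hreg, hcs, key⟩
    have a := key _ (hconst 1)
    have b := key _ (hconst (-1))
    simp only [ContinuousMap.const_apply, integral_const, smul_eq_mul] at a b
    have c : μ.real univ = 1 := by linarith
    refine ⟨?_⟩
    rw [Measure.real, ENNReal.toReal_eq_one_iff] at c
    exact c
  · rintro ⟨hp, hreg, hcs, h⟩
    refine ⟨hreg, hcs, fun ψ => ?_⟩
    refine iSup₂_le ?_
    rintro u ⟨hu, hle⟩
    exact EReal.coe_le_coe_iff.2 ((h u hu).trans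
      (integral_mono (hint μ inferInstance hcs u) (hint μ inferInstance hcs ψ) hle))
end
end

section
/- Let X be a locally compact Hausdorff space countable at infinity and let S ⊆ C(X) be a convex cone containing the constant functions such that the multifunction J^S = {(x,μ) : x ∈ X, μ ∈ J^S_x} is lower semicontinuous. If φ ∈ C(X) is bounded below, then the function E_φ(x) = inf{μ(φ) : μ ∈ J^S_x} is upper semicontinuous on X. -/
open MeasureTheory Topology Filter Set
open scoped ENNReal

noncomputable section

/-- From the proof of Theorem 1.4: if `J^S` is lower semicontinuous and `φ ∈ C(X)` is bounded
below, then `E_φ(x) = inf{μ(φ) : μ ∈ J^S_x}` is upper semicontinuous. -/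
theorem jensen_infimum_upperSemicontinuous {X : Type*} [TopologicalSpace X] [T2Space X]
    [LocallyCompactSpace X] [SigmaCompactSpace X] [MeasurableSpace X] [BorelSpace X]
    (S : Set C(X, ℝ)) (hS : IsConvexCone S)
    (hconst : ∀ c : ℝ, ContinuousMap.const X c ∈ S)
    (hJ : LSCMulti (JensenMeasures S))
    (φ : C(X, ℝ)) (hbd : ∃ c : ℝ, ∀ x : X, c ≤ φ x) :
    UpperSemicontinuous
      (fun x : X => ⨅ μ ∈ JensenMeasures S x, ((∫ y, φ y ∂μ : ℝ) : EReal)) := by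
  intro x a ha
  obtain ⟨μ, hμ, hlt⟩ : ∃ μ ∈ JensenMeasures S x, ((∫ y, φ y ∂μ : ℝ) : EReal) < a := by
    simpa only [iInf_lt_iff, exists_prop] using ha
  obtain ⟨r, hr1, hr2⟩ := EReal.lt_iff_exists_real_btwn.1 hlt
  have hr1' : (∫ y, φ y ∂μ) < r := EReal.coe_lt_coe_iff.1 hr1
  obtain ⟨W, hW, h⟩ := hJ x μ hμ {φ} (r - ∫ y, φ y ∂μ) (sub_pos.2 hr1')
  filter_upwards [hW] with y hy
  obtain ⟨ν, hν, hψ⟩ := h y hy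
  have h1 := (abs_lt.1 (hψ φ (Finset.mem_singleton_self φ))).2
  have h2 : (∫ z, φ z ∂ν) < r := by linarith
  exact lt_of_le_of_lt (iInf₂_le ν hν) ((EReal.coe_lt_coe_iff.2 h2).trans hr2)
end
end
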